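/- (Generalized Lax–Friedrichs splitting property for Ω.) Assume v_min ≥ 0. Let Û = (ρ̂,ŷ,ẑ) and Ǔ = (ρ̌,y̌,ž) be states in Ω := {(ρ,y,z) ∈ ℝ³ : ρ > 0, z > 0, w_min ≤ w(U) ≤ w_max, v(U) ≥ v_min, c_min ≤ c(U) ≤ c_max}. Then for every real α > α_max(Û,Ǔ), the state S_GLF(Û,Ǔ) belongs to Ω. -/

import Mathlib

noncomputable def press (vref γ κ ρ z : ℝ) : ℝ :=
  if 0 < γ then vref / γ * z ^ κ * ρ ^ (γ - κ) else vref * Real.log ρ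

noncomputable def pRho (vref γ κ ρ z : ℝ) : ℝ :=
  if 0 < γ then vref / γ * (γ - κ) * z ^ κ * ρ ^ (γ - κ - 1) else vref / ρ

noncomputable def pZ (vref γ κ ρ z : ℝ) : ℝ :=
  if 0 < γ then vref / γ * κ * z ^ (κ - 1) * ρ ^ (γ - κ) else 0

noncomputable def vel (vref γ κ : ℝ) (U : ℝ × ℝ × ℝ) : ℝ :=
  U.2.1 / U.1 - press vref γ κ U.1 U.2.2

noncomputable def flux (vref γ κ : ℝ) (U : ℝ × ℝ × ℝ) : ℝ × ℝ × ℝ :=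
  vel vref γ κ U • U

noncomputable def sfun (vref γ κ ρ z : ℝ) : ℝ :=
  ρ ^ 2 * pRho vref γ κ ρ z + ρ * z * pZ vref γ κ ρ z

def dot3 (a b : ℝ × ℝ × ℝ) : ℝ := a.1 * b.1 + a.2.1 * b.2.1 + a.2.2 * b.2.2

noncomputable def nvec (vref γ κ vmin ρ z : ℝ) : ℝ × ℝ × ℝ :=
  (-(vmin + press vref γ κ ρ z + ρ * pRho vref γ κ ρ z), 1, -(ρ * pZ vref γ κ ρ z))

noncomputable def abar (vref γ κ : ℝ) (U : ℝ × ℝ × ℝ) : ℝ :=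
  vel vref γ κ U + |U.1 * pRho vref γ κ U.1 U.2.2 + U.2.2 * pZ vref γ κ U.1 U.2.2|

noncomputable def astd (vref γ κ : ℝ) (Uh Uc : ℝ × ℝ × ℝ) : ℝ :=
  max (abar vref γ κ Uh) (abar vref γ κ Uc)

noncomputable def rho1 (Uh Uc : ℝ × ℝ × ℝ) : ℝ := (Uh.1 + Uc.1) / 2

noncomputable def rho2 (vref γ κ : ℝ) (Uh Uc : ℝ × ℝ × ℝ) : ℝ :=
  rho1 Uh Uc + (Uh.1 * vel vref γ κ Uh - Uc.1 * vel vref γ κ Uc) / (2 * astd vref γ κ Uh Uc)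

noncomputable def zet1 (Uh Uc : ℝ × ℝ × ℝ) : ℝ := (Uh.2.2 + Uc.2.2) / 2

noncomputable def zet2 (vref γ κ : ℝ) (Uh Uc : ℝ × ℝ × ℝ) : ℝ :=
  zet1 Uh Uc + (Uh.2.2 * vel vref γ κ Uh - Uc.2.2 * vel vref γ κ Uc) / (2 * astd vref γ κ Uh Uc)

noncomputable def sbar (vref γ κ : ℝ) (Uh Uc : ℝ × ℝ × ℝ) : ℝ :=
  sSup ((fun q : ℝ × ℝ => sfun vref γ κ q.1 q.2) ''
    (Set.Icc (min (rho1 Uh Uc) (rho2 vref γ κ Uh Uc)) (max (rho1 Uh Uc) (rho2 vref γ κ Uh Uc)) ×ˢ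
     Set.Icc (min (zet1 Uh Uc) (zet2 vref γ κ Uh Uc)) (max (zet1 Uh Uc) (zet2 vref γ κ Uh Uc))))

noncomputable def amax (vref γ κ : ℝ) (Uh Uc : ℝ × ℝ × ℝ) : ℝ :=
  max (astd vref γ κ Uh Uc)
    (max (|vel vref γ κ Uh| + sbar vref γ κ Uh Uc / Uh.1)
         (|vel vref γ κ Uc| + sbar vref γ κ Uh Uc / Uc.1))

noncomputable def SGLF (vref γ κ α : ℝ) (U1 U2 : ℝ × ℝ × ℝ) : ℝ × ℝ × ℝ :=
  (1/2 : ℝ) • (U1 + α⁻¹ • flux vref γ κ U1 + U2 - α⁻¹ • flux vref γ κ U2)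

lemma one_add_linear_le_rpow_mul_rpow {κ m x u : ℝ} (hm : 0 ≤ m) (hκ : m + 1 ≤ κ)
    (hx : 0 < x) (hu : 0 < u) :
    1 + κ * (x - 1) - m * (u - 1) ≤ x ^ κ * u ^ (-m) := by
  have hκ0 : 0 < κ := by linarith
  have h := Real.geom_mean_le_arith_mean3_weighted (w₁ := 1 / κ) (w₂ := m / κ)
    (w₃ := (κ - 1 - m) / κ) (p₁ := x ^ κ * u ^ (-m)) (p₂ := u) (p₃ := 1)
    (by positivity) (by positivity) (div_nonneg (by linarith) hκ0.le)
    (by positivity) hu.le zero_le_one (by field_simp; ring)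
  have e : (x ^ κ * u ^ (-m)) ^ (1 / κ) * u ^ (m / κ) * 1 ^ ((κ - 1 - m) / κ) = x := by
    rw [Real.one_rpow, mul_one, Real.mul_rpow (by positivity) (by positivity),
      ← Real.rpow_mul hx.le, ← Real.rpow_mul hu.le, mul_assoc, ← Real.rpow_add hu]
    have h1 : κ * (1 / κ) = 1 := by field_simp
    have h2 : -m * (1 / κ) + m / κ = 0 := by ring
    rw [h1, h2, Real.rpow_one, Real.rpow_zero, mul_one]
  rw [e] at h
  have h' := mul_le_mul_of_nonneg_left h hκ0.le
  have e' : κ * (1 / κ * (x ^ κ * u ^ (-m)) + m / κ * u + (κ - 1 - m) / κ * 1)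
      = x ^ κ * u ^ (-m) + m * u + (κ - 1 - m) := by field_simp
  rw [e'] at h'
  linarith

lemma sfun_of_pos {vref γ κ ρ z : ℝ} (hγ : 0 < γ) (hρ : 0 < ρ) (hz : 0 < z) :
    sfun vref γ κ ρ z = vref * z ^ κ * ρ ^ (γ - κ + 1) := by
  have e1 : ρ ^ (γ - κ - 1) = ρ ^ (γ - κ) / ρ := by rw [Real.rpow_sub hρ, Real.rpow_one]
  have e2 : ρ ^ (γ - κ + 1) = ρ ^ (γ - κ) * ρ := by rw [Real.rpow_add hρ, Real.rpow_one]
  have e3 : z ^ (κ - 1) = z ^ κ / z := by rw [Real.rpow_sub hz, Real.rpow_one]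
  simp only [sfun, pRho, pZ, if_pos hγ, e1, e2, e3]
  field_simp
  ring

lemma sfun_of_not_pos {vref γ κ ρ z : ℝ} (hγ : ¬ 0 < γ) (hρ : 0 < ρ) :
    sfun vref γ κ ρ z = vref * ρ := by
  simp only [sfun, pRho, pZ, if_neg hγ]
  field_simp
  ring

lemma sfun_pos {vref γ κ ρ z : ℝ} (hv : 0 < vref) (hρ : 0 < ρ) (hz : 0 < z) :
    0 < sfun vref γ κ ρ z := by
  by_cases hγ : 0 < γ
  · rw [sfun_of_pos hγ hρ hz]; positivity
  · rw [sfun_of_not_pos hγ hρ]; positivity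

lemma mul_press_tangent_le {vref γ κ r z R Z : ℝ} (hv : 0 < vref) (hκ : γ + 1 ≤ κ)
    (hr : 0 < r) (hz : 0 < z) (hR : 0 < R) (hZ : 0 < Z) :
    r * press vref γ κ r z + (press vref γ κ r z + r * pRho vref γ κ r z) * (R - r)
      + r * pZ vref γ κ r z * (Z - z) ≤ R * press vref γ κ R Z := by
  by_cases hγ : 0 < γ
  · have e1 : r ^ (γ - κ - 1) = r ^ (γ - κ) / r := by rw [Real.rpow_sub hr, Real.rpow_one]
    have e3 : z ^ (κ - 1) = z ^ κ / z := by rw [Real.rpow_sub hz, Real.rpow_one]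
    have h := one_add_linear_le_rpow_mul_rpow (m := κ - γ - 1) (κ := κ) (by linarith) (by linarith)
      (div_pos hZ hz) (div_pos hR hr)
    have hc : 0 ≤ vref / γ * z ^ κ * r ^ (γ - κ) * r := by positivity
    have h' := mul_le_mul_of_nonneg_left h hc
    have e : vref / γ * z ^ κ * r ^ (γ - κ) * r * ((Z / z) ^ κ * (R / r) ^ (-(κ - γ - 1)))
        = R * (vref / γ * Z ^ κ * R ^ (γ - κ)) := by
      rw [show -(κ - γ - 1) = γ - κ + 1 by ring, Real.div_rpow hZ.le hz.le,
        Real.div_rpow hR.le hr.le, Real.rpow_add hR, Real.rpow_add hr, Real.rpow_one,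
        Real.rpow_one]
      field_simp
    rw [e] at h'
    simp only [press, pRho, pZ, if_pos hγ, e1, e3]
    refine le_trans (le_of_eq ?_) h'
    field_simp
    ring
  · simp only [press, pRho, pZ, if_neg hγ]
    have h := Real.log_le_sub_one_of_pos (div_pos hr hR)
    rw [Real.log_div hr.ne' hR.ne'] at h
    have h' := mul_le_mul_of_nonneg_left h (mul_pos hv hR).le
    have e : vref * R * (r / R - 1) = vref * r - vref * R := by field_simp
    have e' : r * (vref / r) = vref := by field_simp
    rw [e] at h'
    rw [e']
    linarith

lemma bddAbove_sfun_image {vref γ κ r₀ r₁ z₀ z₁ : ℝ} (hr : 0 < r₀)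
    (hz : 0 < z₀) :
    BddAbove ((fun q : ℝ × ℝ => sfun vref γ κ q.1 q.2) '' (Set.Icc r₀ r₁ ×ˢ Set.Icc z₀ z₁)) := by
  refine (IsCompact.image_of_continuousOn (isCompact_Icc.prod isCompact_Icc) ?_).bddAbove
  by_cases hγ : 0 < γ
  · refine ContinuousOn.congr (f := fun q : ℝ × ℝ => vref * q.2 ^ κ * q.1 ^ (γ - κ + 1)) ?_ ?_
    · refine (continuousOn_const.mul (continuousOn_snd.rpow_const ?_)).mul
        (continuousOn_fst.rpow_const ?_)
      · rintro ⟨a, b⟩ ⟨_, hb⟩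
        exact Or.inl (hz.trans_le hb.1).ne'
      · rintro ⟨a, b⟩ ⟨ha, _⟩
        exact Or.inl (hr.trans_le ha.1).ne'
    · rintro ⟨a, b⟩ ⟨ha, hb⟩
      exact sfun_of_pos hγ (hr.trans_le ha.1) (hz.trans_le hb.1)
  · refine ContinuousOn.congr (f := fun q : ℝ × ℝ => vref * q.1) (by fun_prop) ?_
    rintro ⟨a, b⟩ ⟨ha, _⟩
    exact sfun_of_not_pos hγ (hr.trans_le ha.1)

lemma add_div_mem_Icc_min_max {x D a b : ℝ} (ha : 0 < a) (hab : a ≤ b) :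
    x + D / (2 * b) ∈ Set.Icc (min x (x + D / (2 * a))) (max x (x + D / (2 * a))) := by
  have hb : 0 < b := ha.trans_le hab
  rcases le_total 0 D with hD | hD
  · have h1 : 0 ≤ D / (2 * b) := by positivity
    have h2 : D / (2 * b) ≤ D / (2 * a) := by gcongr
    exact ⟨(min_le_left _ _).trans (by linarith), le_max_of_le_right (by linarith)⟩
  · have h1 : D / (2 * b) ≤ 0 := div_nonpos_of_nonpos_of_nonneg hD (by positivity)
    have h2 : -D / (2 * b) ≤ -D / (2 * a) := by
      have : 0 ≤ -D := by linarith
      gcongr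
    rw [neg_div, neg_div] at h2
    exact ⟨(min_le_right _ _).trans (by linarith), le_max_of_le_left (by linarith)⟩

lemma vel_lt_abar {vref γ κ : ℝ} {U : ℝ × ℝ × ℝ} (hv : 0 < vref) (hρ : 0 < U.1)
    (hz : 0 < U.2.2) : vel vref γ κ U < abar vref γ κ U := by
  have h : U.1 * pRho vref γ κ U.1 U.2.2 + U.2.2 * pZ vref γ κ U.1 U.2.2
      = sfun vref γ κ U.1 U.2.2 / U.1 := by
    rw [sfun]; field_simp
  rw [abar, h]
  have := div_pos (sfun_pos (γ := γ) (κ := κ) hv hρ hz) hρ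
  linarith [le_abs_self (sfun vref γ κ U.1 U.2.2 / U.1)]

lemma half_add_div_pos {x x' v v' a : ℝ} (hx : 0 < x) (hx' : 0 < x') (hv : 0 ≤ v) (ha : 0 < a)
    (hv' : v' < a) : 0 < (x + x') / 2 + (x * v - x' * v') / (2 * a) := by
  have h : (x + x') / 2 + (x * v - x' * v') / (2 * a)
      = (x * (a + v) + x' * (a - v')) / (2 * a) := by field_simp; ring
  rw [h]
  have : 0 < a - v' := by linarith
  positivity

/-- The split state `a • Û + b • Ǔ`, with possibly non-normalized weights, keeps the lower
velocity bound as soon as the defect `(a + b - 1) * s` is controlled. -/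
lemma le_vel_of_weights {vref γ κ vmin a b : ℝ} {U V S : ℝ × ℝ × ℝ} (hv : 0 < vref)
    (hκ : γ + 1 ≤ κ) (ha : 0 < a) (hb : 0 < b) (hU : 0 < U.1) (hUz : 0 < U.2.2)
    (hV : 0 < V.1) (hVz : 0 < V.2.2) (hS : S = a • U + b • V)
    (hdef : (a + b - 1) * sfun vref γ κ S.1 S.2.2
      ≤ a * (U.1 * (vel vref γ κ U - vmin)) + b * (V.1 * (vel vref γ κ V - vmin))) :
    vmin ≤ vel vref γ κ S := by
  have e1 : S.1 = a * U.1 + b * V.1 := by rw [hS]; simp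
  have e2 : S.2.1 = a * U.2.1 + b * V.2.1 := by rw [hS]; simp
  have e3 : S.2.2 = a * U.2.2 + b * V.2.2 := by rw [hS]; simp
  have hS1 : 0 < S.1 := by rw [e1]; positivity
  have hS3 : 0 < S.2.2 := by rw [e3]; positivity
  have tU := mul_le_mul_of_nonneg_left (mul_press_tangent_le hv hκ hS1 hS3 hU hUz) ha.le
  have tV := mul_le_mul_of_nonneg_left (mul_press_tangent_le hv hκ hS1 hS3 hV hVz) hb.le
  have yU : U.1 * vel vref γ κ U = U.2.1 - U.1 * press vref γ κ U.1 U.2.2 := by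
    rw [vel]; field_simp
  have yV : V.1 * vel vref γ κ V = V.2.1 - V.1 * press vref γ κ V.1 V.2.2 := by
    rw [vel]; field_simp
  rw [mul_sub U.1, mul_sub V.1, yU, yV] at hdef
  have key : S.1 * (vmin + press vref γ κ S.1 S.2.2) ≤ S.2.1 := by
    rw [sfun] at hdef
    set P := press vref γ κ S.1 S.2.2
    set A := pRho vref γ κ S.1 S.2.2
    set B := pZ vref γ κ S.1 S.2.2
    rw [e2]
    rw [e1, e3] at tU tV hdef
    rw [e1]
    linear_combination tU + tV + hdef
  rw [vel, le_sub_iff_add_le, le_div_iff₀ hS1]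
  linarith

lemma le_weighted_div {a b r r' x x' m : ℝ} (ha : 0 < a) (hb : 0 < b) (hr : 0 < r) (hr' : 0 < r')
    (h : m ≤ x / r) (h' : m ≤ x' / r') : m ≤ (a * x + b * x') / (a * r + b * r') := by
  rw [le_div_iff₀ hr] at h
  rw [le_div_iff₀ hr'] at h'
  rw [le_div_iff₀ (by positivity)]
  nlinarith

lemma weighted_div_le {a b r r' x x' m : ℝ} (ha : 0 < a) (hb : 0 < b) (hr : 0 < r) (hr' : 0 < r')
    (h : x / r ≤ m) (h' : x' / r' ≤ m) : (a * x + b * x') / (a * r + b * r') ≤ m := by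
  rw [div_le_iff₀ hr] at h
  rw [div_le_iff₀ hr'] at h'
  rw [div_le_iff₀ (by positivity)]
  nlinarith

lemma split_defect_le {α ρ v v' vmin s : ℝ} (hα : 0 < α) (hρ : 0 < ρ) (hs : 0 ≤ s)
    (hv0 : 0 ≤ v) (hv : vmin ≤ v) (hv' : vmin ≤ v') (h : s ≤ α * ρ) :
    (v - v') / (2 * α) * s ≤ (1 + v / α) / 2 * (ρ * (v - vmin)) := by
  have e : (1 + v / α) / 2 * (ρ * (v - vmin)) = (α + v) * ρ * (v - vmin) / (2 * α) := by
    field_simp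
  rw [e, div_mul_eq_mul_div]
  refine div_le_div_of_nonneg_right ?_ (by positivity)
  have h1 : (v - v') * s ≤ (v - vmin) * s := mul_le_mul_of_nonneg_right (by linarith) hs
  have h2 : s ≤ (α + v) * ρ := by nlinarith
  have h3 := mul_le_mul_of_nonneg_left h2 (sub_nonneg.2 hv)
  linarith

theorem stmt_10 (vref γ κ vmin wmin wmax cmin cmax : ℝ)
    (hvref : 0 < vref) (hγ : 0 ≤ γ) (hκ : γ + 1 ≤ κ) (hvmin : 0 ≤ vmin)
    (hw : wmin ≤ wmax) (hc : cmin ≤ cmax)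
    (Uh Uc : ℝ × ℝ × ℝ)
    (hUh : Uh ∈ {U : ℝ × ℝ × ℝ | 0 < U.1 ∧ 0 < U.2.2 ∧
        wmin ≤ U.2.1 / U.1 ∧ U.2.1 / U.1 ≤ wmax ∧ vmin ≤ vel vref γ κ U ∧
        cmin ≤ U.2.2 / U.1 ∧ U.2.2 / U.1 ≤ cmax})
    (hUc : Uc ∈ {U : ℝ × ℝ × ℝ | 0 < U.1 ∧ 0 < U.2.2 ∧
        wmin ≤ U.2.1 / U.1 ∧ U.2.1 / U.1 ≤ wmax ∧ vmin ≤ vel vref γ κ U ∧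
        cmin ≤ U.2.2 / U.1 ∧ U.2.2 / U.1 ≤ cmax})
    (α : ℝ) (hα : amax vref γ κ Uh Uc < α) :
    SGLF vref γ κ α Uh Uc ∈
      {U : ℝ × ℝ × ℝ | 0 < U.1 ∧ 0 < U.2.2 ∧
        wmin ≤ U.2.1 / U.1 ∧ U.2.1 / U.1 ≤ wmax ∧ vmin ≤ vel vref γ κ U ∧
        cmin ≤ U.2.2 / U.1 ∧ U.2.2 / U.1 ≤ cmax} := by
  obtain ⟨hr, hz, hw1, hw2, hvU, hc1, hc2⟩ := hUh
  obtain ⟨hr', hz', hw1', hw2', hvV, hc1', hc2'⟩ := hUc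
  obtain ⟨hα1, hα2⟩ := max_lt_iff.1 hα
  have hα2 := (max_lt_iff.1 hα2).1
  have hvU0 : 0 ≤ vel vref γ κ Uh := hvmin.trans hvU
  have hA : 0 < astd vref γ κ Uh Uc :=
    (hvU0.trans_lt (vel_lt_abar hvref hr hz)).trans_le (le_max_left _ _)
  have hvA : vel vref γ κ Uc < astd vref γ κ Uh Uc :=
    (vel_lt_abar hvref hr' hz').trans_le (le_max_right _ _)
  have hα0 : 0 < α := hA.trans hα1
  set v := vel vref γ κ Uh with hv
  set v' := vel vref γ κ Uc with hv'
  obtain ⟨a, ha⟩ : ∃ a, a = (1 + v / α) / 2 := ⟨_, rfl⟩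
  obtain ⟨b, hb⟩ : ∃ b, b = (1 - v' / α) / 2 := ⟨_, rfl⟩
  have ha0 : 0 < a := by rw [ha]; positivity
  have hb0 : 0 < b := by
    have : v' / α < 1 := (div_lt_one hα0).2 (hvA.trans hα1)
    rw [hb]; linarith
  have hS : SGLF vref γ κ α Uh Uc = a • Uh + b • Uc := by
    rw [SGLF, flux, flux, ← hv, ← hv', ha, hb]
    module
  have e1 : (SGLF vref γ κ α Uh Uc).1 = a * Uh.1 + b * Uc.1 := by rw [hS]; simp
  have e2 : (SGLF vref γ κ α Uh Uc).2.1 = a * Uh.2.1 + b * Uc.2.1 := by rw [hS]; simp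
  have e3 : (SGLF vref γ κ α Uh Uc).2.2 = a * Uh.2.2 + b * Uc.2.2 := by rw [hS]; simp
  have hS1 : 0 < (SGLF vref γ κ α Uh Uc).1 := by rw [e1]; positivity
  have hS3 : 0 < (SGLF vref γ κ α Uh Uc).2.2 := by rw [e3]; positivity
  refine ⟨hS1, hS3, ?_, ?_, ?_, ?_, ?_⟩
  · rw [e1, e2]; exact le_weighted_div ha0 hb0 hr hr' hw1 hw1'
  · rw [e1, e2]; exact weighted_div_le ha0 hb0 hr hr' hw2 hw2'
  · refine le_vel_of_weights hvref hκ ha0 hb0 hr hz hr' hz' hS ?_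
    rw [← hv, ← hv']
    have hs0 := sfun_pos (γ := γ) (κ := κ) hvref hS1 hS3
    have hs : sfun vref γ κ (SGLF vref γ κ α Uh Uc).1 (SGLF vref γ κ α Uh Uc).2.2
        ≤ sbar vref γ κ Uh Uc := by
      refine le_csSup (bddAbove_sfun_image (lt_min ?_ ?_) (lt_min ?_ ?_))
        ⟨((SGLF vref γ κ α Uh Uc).1, (SGLF vref γ κ α Uh Uc).2.2), ⟨?_, ?_⟩, rfl⟩
      · rw [rho1]; positivity
      · exact half_add_div_pos hr hr' hvU0 hA hvA
      · rw [zet1]; positivity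
      · exact half_add_div_pos hz hz' hvU0 hA hvA
      · have e : (SGLF vref γ κ α Uh Uc).1
            = rho1 Uh Uc + (Uh.1 * v - Uc.1 * v') / (2 * α) := by
          rw [e1, ha, hb, rho1]; field_simp; ring
        exact e ▸ add_div_mem_Icc_min_max hA hα1.le
      · have e : (SGLF vref γ κ α Uh Uc).2.2
            = zet1 Uh Uc + (Uh.2.2 * v - Uc.2.2 * v') / (2 * α) := by
          rw [e3, ha, hb, zet1]; field_simp; ring
        exact e ▸ add_div_mem_Icc_min_max hA hα1.le
    have ht : a + b - 1 = (v - v') / (2 * α) := by rw [ha, hb]; field_simp; ring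
    have hV0 : 0 ≤ b * (Uc.1 * (v' - vmin)) :=
      mul_nonneg hb0.le (mul_nonneg hr'.le (sub_nonneg.2 hvV))
    have h1 : sbar vref γ κ Uh Uc / Uh.1 < α := by linarith [abs_nonneg v]
    rw [div_lt_iff₀ hr] at h1
    rw [ht]
    have h2 := split_defect_le hα0 hr hs0.le hvU0 hvU hvV (hs.trans h1.le)
    rw [← ha] at h2
    linarith
  · rw [e1, e3]; exact le_weighted_div ha0 hb0 hr hr' hc1 hc1'
  · rw [e1, e3]; exact weighted_div_le ha0 hb0 hr hr' hc2 hc2'
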